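/- For every s, t ∈ ℝ^d and every a ∈ ℓ²(ℤ^d), the operators T_t on ℓ²(ℤ^d) satisfy: T_s(T_t(a)) = T_t(T_s(a)) = T_{s+t}(a); T_t is invertible with inverse T_{−t}; and T_t is an isometry, i.e. ‖T_t(a)‖_{ℓ²(ℤ^d)} = ‖a‖_{ℓ²(ℤ^d)}. -/

import Mathlib

open MeasureTheory Real

noncomputable section
open Classical in

/-- The operator `T_{s e_j}` acting on (two-sided) sequences indexed by `ℤ^d`:
`(T_{s e_j} a)_n = (sin(πs)/π) Σ_{m ∈ ℤ} a_{(n₁,…,m,…,n_d)}/(n_j - m + s)` for `s ∉ ℤ`,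
and `(T_{s e_j} a)_n = (-1)^s a_{n + s e_j}` for `s ∈ ℤ`. -/
def Tcoord {d : ℕ} (j : Fin d) (s : ℝ) (a : (Fin d → ℤ) → ℂ) : (Fin d → ℤ) → ℂ :=
  fun n =>
    if hs : ∃ k : ℤ, s = (k : ℝ) then
      (-1 : ℂ) ^ hs.choose * a (Function.update n j (n j + hs.choose))
    else
      ((Real.sin (Real.pi * s) / Real.pi : ℝ) : ℂ) *
        ∑' m : ℤ, a (Function.update n j m) / (((n j : ℤ) : ℂ) - (m : ℂ) + (s : ℂ))

/-- For `t = (t₁, …, t_d) ∈ ℝ^d`, `T_t = T_{t₁e₁} ∘ T_{t₂e₂} ∘ ⋯ ∘ T_{t_d e_d}`. -/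
def Tvec {d : ℕ} (t : Fin d → ℝ) : ((Fin d → ℤ) → ℂ) → ((Fin d → ℤ) → ℂ) :=
  (List.ofFn fun j : Fin d => Tcoord j (t j)).foldr (· ∘ ·) id

section FourierModel

open AddCircle UnitAddTorus
open scoped ComplexConjugate

local instance : MeasureSpace UnitAddCircle := ⟨AddCircle.haarAddCircle⟩

local instance : IsProbabilityMeasure (volume : Measure UnitAddCircle) :=
  inferInstanceAs (IsProbabilityMeasure AddCircle.haarAddCircle)

/-- The unimodular function `x ↦ exp (π i s (1 - 2 x))` on `(0, 1]`, seen as a function on the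
circle. Multiplication by it corresponds to the one-dimensional operator `T_s` on Fourier
coefficients. -/
def twist (s : ℝ) (x : UnitAddCircle) : ℂ :=
  Complex.exp (((π * s * (1 - 2 * (equivIoc (1 : ℝ) 0 x : ℝ)) : ℝ) : ℂ) * Complex.I)

lemma norm_twist (s : ℝ) (x : UnitAddCircle) : ‖twist s x‖ = 1 :=
  Complex.norm_exp_ofReal_mul_I _

lemma conj_twist (s : ℝ) (x : UnitAddCircle) : conj (twist s x) = twist (-s) x := by
  simp only [twist, ← Complex.exp_conj, map_mul, Complex.conj_ofReal, Complex.conj_I]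
  congr 1
  push_cast
  ring

lemma twist_zero (x : UnitAddCircle) : twist 0 x = 1 := by simp [twist]

lemma twist_add (s t : ℝ) (x : UnitAddCircle) : twist (s + t) x = twist s x * twist t x := by
  simp only [twist, ← Complex.exp_add]
  congr 1
  push_cast
  ring

lemma measurable_twist (s : ℝ) : Measurable (twist s) := by
  have h : Measurable fun x : UnitAddCircle => (equivIoc (1 : ℝ) 0 x : ℝ) :=
    measurable_subtype_coe.comp (measurableEquivIoc (1 : ℝ) 0).measurable
  unfold twist
  fun_prop

lemma integral_fourier_mul_twist_eq_interval (s : ℝ) (k : ℤ) :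
    ∫ x : UnitAddCircle, fourier k x * twist s x =
      Complex.exp (π * s * Complex.I) *
        ∫ x in (0 : ℝ)..1, Complex.exp ((2 * π * (k - s) * Complex.I) * x) := by
  have h1 : (volume : Measure UnitAddCircle) =
      (AddCircle.measureSpace 1).volume := by
    rw [AddCircle.volume_eq_smul_haarAddCircle]
    simp
    rfl
  rw [h1, ← AddCircle.intervalIntegral_preimage 1 0, zero_add,
    ← intervalIntegral.integral_const_mul]
  refine intervalIntegral.integral_congr_ae (Filter.Eventually.of_forall fun x hx => ?_)
  rw [Set.uIoc_of_le zero_le_one] at hx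
  rw [twist, equivIoc_coe_of_mem (p := (1 : ℝ)) (by simpa using hx), fourier_coe_apply,
    ← Complex.exp_add, ← Complex.exp_add]
  congr 1
  push_cast
  ring

lemma integral_fourier_mul_twist_self (k : ℤ) :
    ∫ x : UnitAddCircle, fourier k x * twist k x = (-1 : ℂ) ^ k := by
  rw [integral_fourier_mul_twist_eq_interval]
  simp only [Complex.ofReal_intCast, sub_self, mul_zero, zero_mul, Complex.exp_zero,
    intervalIntegral.integral_const, sub_zero, one_smul, mul_one]
  rw [← Complex.exp_pi_mul_I, ← Complex.exp_int_mul]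
  congr 1
  ring

lemma integral_fourier_mul_twist_of_ne {s : ℝ} {k : ℤ} (h : s ≠ k) :
    ∫ x : UnitAddCircle, fourier k x * twist s x =
      ((Real.sin (π * s) / π : ℝ) : ℂ) / (s - k) := by
  have hc : (s : ℂ) - k ≠ 0 := by
    rw [sub_ne_zero]
    exact_mod_cast h
  have hc' : (k : ℂ) - s ≠ 0 := by
    rw [← neg_sub]; exact neg_ne_zero.mpr hc
  have hpi : (π : ℂ) ≠ 0 := by exact_mod_cast Real.pi_ne_zero
  rw [integral_fourier_mul_twist_eq_interval, integral_exp_mul_complex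
    (by simp [hc', hpi, Complex.I_ne_zero])]
  have h1 : Complex.exp (2 * π * (k - s) * Complex.I * (1 : ℝ)) =
      Complex.exp (-(π * s * Complex.I)) * Complex.exp (-(π * s * Complex.I)) := by
    rw [← Complex.exp_add]
    refine Complex.exp_eq_exp_iff_exists_int.mpr ⟨k, ?_⟩
    push_cast
    ring
  have h2 : Complex.exp (π * s * Complex.I) * Complex.exp (-(π * s * Complex.I)) = 1 := by
    rw [← Complex.exp_add, add_neg_cancel, Complex.exp_zero]
  rw [h1]
  push_cast
  rw [Complex.sin, neg_mul]
  rw [mul_zero, Complex.exp_zero, mul_div_assoc', mul_sub, ← mul_assoc, h2, one_mul, mul_one]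
  rw [div_div, div_div, div_eq_div_iff (by simp [hc', hpi, Complex.I_ne_zero]) (by
    simp [hc, hpi])]
  ring_nf
  rw [Complex.I_sq]
  ring

variable {d : ℕ}

lemma integral_mFourier_mul_twist (j : Fin d) (s : ℝ) (k : Fin d → ℤ) :
    ∫ x : UnitAddTorus (Fin d), mFourier k x * twist s (x j) =
      ∏ i, ∫ y : UnitAddCircle, fourier (k i) y * (if i = j then twist s y else 1) := by
  rw [← integral_fintype_prod_volume_eq_prod
    (fun i (y : UnitAddCircle) => fourier (k i) y * (if i = j then twist s y else 1))]
  simp only [mFourier, ContinuousMap.coe_mk, Finset.prod_mul_distrib, Finset.prod_ite_eq',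
    Finset.mem_univ, if_true]

lemma integral_fourier_eq_ite (k : ℤ) :
    ∫ y : UnitAddCircle, fourier k y = if k = 0 then 1 else 0 := by
  have h : ∫ y : UnitAddCircle, fourier k y * twist 0 y = ∫ y : UnitAddCircle, fourier k y := by
    simp only [twist_zero, mul_one]
  rw [← h]
  split_ifs with hk
  · subst hk
    simpa using integral_fourier_mul_twist_self 0
  · rw [integral_fourier_mul_twist_of_ne (by exact_mod_cast Ne.symm hk)]
    simp

lemma integral_mFourier_mul_twist_of_ne (j : Fin d) (s : ℝ) {k : Fin d → ℤ} {i : Fin d}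
    (hij : i ≠ j) (hk : k i ≠ 0) :
    ∫ x : UnitAddTorus (Fin d), mFourier k x * twist s (x j) = 0 := by
  rw [integral_mFourier_mul_twist]
  refine Finset.prod_eq_zero (Finset.mem_univ i) ?_
  simp only [if_neg hij, mul_one]
  rw [integral_fourier_eq_ite, if_neg hk]

lemma integral_mFourier_single_mul_twist (j : Fin d) (s : ℝ) {k : Fin d → ℤ}
    (hk : ∀ i, i ≠ j → k i = 0) :
    ∫ x : UnitAddTorus (Fin d), mFourier k x * twist s (x j) =
      ∫ x : UnitAddCircle, fourier (k j) x * twist s x := by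
  rw [integral_mFourier_mul_twist, Finset.prod_eq_single j]
  · simp only [if_true]
  · intro i _ hij
    simp only [if_neg hij, mul_one]
    rw [integral_fourier_eq_ite, if_pos (hk i hij)]
  · simp

/-- `a` is the family of Fourier coefficients of the square-integrable function `f`. -/
def IsFourierPair (f : UnitAddTorus (Fin d) → ℂ) (a : (Fin d → ℤ) → ℂ) : Prop :=
  MemLp f 2 volume ∧ mFourierCoeff f = a

lemma exists_isFourierPair {a : (Fin d → ℤ) → ℂ} (ha : Memℓp a 2) :
    ∃ f, IsFourierPair f a := by
  refine ⟨mFourierBasis.repr.symm ⟨a, ha⟩, Lp.memLp _, funext fun n => ?_⟩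
  rw [← mFourierBasis_repr, LinearIsometryEquiv.apply_symm_apply]

lemma mFourierCoeff_congr_ae {f g : UnitAddTorus (Fin d) → ℂ} (h : f =ᵐ[volume] g) :
    mFourierCoeff f = mFourierCoeff g := by
  funext n
  refine integral_congr_ae ?_
  filter_upwards [h] with x hx
  rw [hx]

namespace IsFourierPair

variable {f g : UnitAddTorus (Fin d) → ℂ} {a b : (Fin d → ℤ) → ℂ}

lemma hasSum_norm_sq (h : IsFourierPair f a) :
    HasSum (fun n => ‖a n‖ ^ 2) (∫ x, ‖f x‖ ^ 2) := by
  have key := hasSum_sq_mFourierCoeff h.1.toLp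
  simp only [mFourierCoeff_congr_ae h.1.coeFn_toLp] at key
  simp only [h.2] at key
  convert! key using 1
  refine integral_congr_ae ?_
  filter_upwards [h.1.coeFn_toLp] with x hx
  rw [hx]

lemma memℓp (h : IsFourierPair f a) : Memℓp a 2 := by
  rw [memℓp_gen_iff (by norm_num)]
  simpa using h.hasSum_norm_sq.summable

lemma memLp_mul_twist (h : MemLp f 2 volume) (j : Fin d) (s : ℝ) :
    MemLp (fun x => twist s (x j) * f x) 2 volume := by
  refine h.of_le ?_ ?_
  · exact ((measurable_twist s).comp (measurable_pi_apply j)).aestronglyMeasurable.mul h.1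
  · exact Filter.Eventually.of_forall fun x => by simp [norm_twist]

/-- Parseval's identity for the coefficients of the product of `f` with a twist. -/
lemma hasSum_twist_mul (h : IsFourierPair f a) (j : Fin d) (s : ℝ) (n : Fin d → ℤ) :
    HasSum (fun p => (∫ x, mFourier (p - n) x * twist s (x j)) * a p)
      (mFourierCoeff (fun x => twist s (x j) * f x) n) := by
  have hG : MemLp (fun x : UnitAddTorus (Fin d) => twist (-s) (x j) * mFourier n x) 2 volume :=
    memLp_mul_twist ((Lp.memLp (mFourierLp 2 n)).ae_eq (coeFn_mFourierLp 2 n)) j (-s)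
  have key := hasSum_prod_mFourierCoeff hG.toLp h.1.toLp
  simp only [mFourierCoeff_congr_ae h.1.coeFn_toLp, mFourierCoeff_congr_ae hG.coeFn_toLp] at key
  simp only [h.2] at key
  convert! key using 1
  · funext p
    congr 1
    rw [mFourierCoeff, ← integral_conj]
    refine integral_congr_ae (Filter.Eventually.of_forall fun x => ?_)
    simp only [smul_eq_mul, map_mul, conj_twist, neg_neg, ← mFourier_neg]
    rw [sub_eq_add_neg, mFourier_add]
    ring
  · refine integral_congr_ae ?_
    filter_upwards [h.1.coeFn_toLp, hG.coeFn_toLp] with x hx hx'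
    rw [hx, hx']
    simp only [smul_eq_mul, map_mul, conj_twist, neg_neg, ← mFourier_neg]
    ring

lemma twist_mul (h : IsFourierPair f a) (j : Fin d) (s : ℝ) :
    IsFourierPair (fun x => twist s (x j) * f x) (Tcoord j s a) := by
  refine ⟨memLp_mul_twist h.1 j s, funext fun n => ?_⟩
  have key : HasSum (fun m : ℤ =>
      (∫ x, fourier (m - n j) x * twist s x) * a (Function.update n j m))
      (mFourierCoeff (fun x => twist s (x j) * f x) n) := by
    have h0 := h.hasSum_twist_mul j s n
    rw [← (Function.update_injective n j).hasSum_iff] at h0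
    · convert! h0 using 1
      funext m
      rw [Function.comp_apply, integral_mFourier_single_mul_twist]
      · simp
      · intro i hij
        simp [hij]
    · intro p hp
      obtain ⟨i, hij, hi⟩ : ∃ i, i ≠ j ∧ (p - n) i ≠ 0 := by
        by_contra! hcon
        refine hp ⟨p j, funext fun i => ?_⟩
        rcases eq_or_ne i j with rfl | hij
        · simp
        · simpa [hij, sub_eq_zero, eq_comm] using hcon i hij
      rw [integral_mFourier_mul_twist_of_ne j s hij hi, zero_mul]
  unfold Tcoord
  split_ifs with hs
  · have hk := hs.choose_spec
    set k := hs.choose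
    have hsum := hasSum_single (n j + k) (f := fun m : ℤ =>
      (∫ x, fourier (m - n j) x * twist s x) * a (Function.update n j m)) fun m hm => ?_
    · rw [key.unique hsum, add_sub_cancel_left, hk, integral_fourier_mul_twist_self]
    · have hne : k ≠ m - n j := by omega
      rw [hk, integral_fourier_mul_twist_of_ne (by exact_mod_cast hne), mul_comm π,
        Real.sin_int_mul_pi]
      simp
  · rw [← key.tsum_eq, ← tsum_mul_left]
    refine tsum_congr fun m => ?_
    rw [integral_fourier_mul_twist_of_ne fun hm => hs ⟨_, hm⟩]
    push_cast
    rw [show (s : ℂ) - (m - n j) = n j - m + s by ring]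
    ring

lemma congr_mul (h : IsFourierPair f a) (h' : ∀ x, f x = g x) : IsFourierPair g a :=
  (funext h' : f = g) ▸ h

lemma unique (h : IsFourierPair f a) (h' : IsFourierPair f b) : a = b :=
  h.2.symm.trans h'.2

lemma foldr_twist_mul (h : IsFourierPair f a) (t : Fin d → ℝ) (l : List (Fin d)) :
    IsFourierPair (fun x => (l.map fun j => twist (t j) (x j)).prod * f x)
      ((l.map fun j => Tcoord j (t j)).foldr (· ∘ ·) id a) := by
  induction l with
  | nil => simpa using h
  | cons j l ih => simpa [mul_assoc] using ih.twist_mul j (t j)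

/-- On the Fourier side, `T_t` is multiplication by a product of one-dimensional twists. -/
lemma prod_twist_mul (h : IsFourierPair f a) (t : Fin d → ℝ) :
    IsFourierPair (fun x => (∏ j, twist (t j) (x j)) * f x) (Tvec t a) := by
  simpa [Tvec, List.ofFn_eq_map, Fin.prod_univ_def] using h.foldr_twist_mul t (List.finRange d)

lemma tvec_tvec (h : IsFourierPair f a) (s t : Fin d → ℝ) :
    Tvec s (Tvec t a) = Tvec (s + t) a := by
  refine ((h.prod_twist_mul t).prod_twist_mul s).congr_mul (fun x => ?_) |>.unique
    (h.prod_twist_mul (s + t))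
  simp only [Pi.add_apply, twist_add, Finset.prod_mul_distrib, mul_assoc]

lemma tvec_zero (h : IsFourierPair f a) : Tvec 0 a = a :=
  ((h.prod_twist_mul 0).congr_mul fun x => by simp [twist_zero]).unique h

lemma tsum_norm_sq_tvec (h : IsFourierPair f a) (t : Fin d → ℝ) :
    ∑' n, ‖Tvec t a n‖ ^ 2 = ∑' n, ‖a n‖ ^ 2 := by
  rw [h.hasSum_norm_sq.tsum_eq, (h.prod_twist_mul t).hasSum_norm_sq.tsum_eq]
  simp [norm_prod, norm_twist]

end IsFourierPair

end FourierModel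

/-- Theorem 3.2 a: the operators `T_t` on `ℓ²(ℤ^d)` commute and form a
group: `T_s ∘ T_t = T_t ∘ T_s = T_{s+t}`, `T_t⁻¹ = T_{-t}`, `T_t` maps `ℓ²` into `ℓ²`
and is an isometry of `ℓ²(ℤ^d)`. -/
theorem statement6 {d : ℕ} (s t : Fin d → ℝ) (a : (Fin d → ℤ) → ℂ) (ha : Memℓp a 2) :
    Tvec s (Tvec t a) = Tvec t (Tvec s a) ∧
    Tvec s (Tvec t a) = Tvec (s + t) a ∧
    Tvec t (Tvec (-t) a) = a ∧
    Tvec (-t) (Tvec t a) = a ∧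
    Memℓp (Tvec t a) 2 ∧
    ∑' n : Fin d → ℤ, ‖Tvec t a n‖ ^ 2 = ∑' n : Fin d → ℤ, ‖a n‖ ^ 2 := by
  obtain ⟨f, hf⟩ := exists_isFourierPair ha
  refine ⟨?_, hf.tvec_tvec s t, ?_, ?_, (hf.prod_twist_mul t).memℓp, hf.tsum_norm_sq_tvec t⟩
  · rw [hf.tvec_tvec, hf.tvec_tvec, add_comm]
  · rw [hf.tvec_tvec, add_neg_cancel, hf.tvec_zero]
  · rw [hf.tvec_tvec, neg_add_cancel, hf.tvec_zero]
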